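/- Concatenation lemma: in the Coxeter setting below, assume W is finite with longest element w_0. Let π, η : [0,T] → V be continuous paths with π(0) = η(0) = 0, and let π ⋆ η denote their concatenation. Then for every w ∈ W there exists a continuous path η' : [0,T] → V with η'(0) = 0 such that P_w(π ⋆ η) = (P_w π) ⋆ η' and P_{w_0} η' = P_{w_0} η. -/

import Mathlib

/-- The Pitman transform associated with a pair `(α, α∨)`:
`P_α π (t) = π t − (inf_{0 ≤ s ≤ t} α∨(π s)) • α`. -/
noncomputable def pitman {V : Type*} [AddCommGroup V] [Module ℝ V]
    (α : V) (αv : Module.Dual ℝ V) (π : ℝ → V) : ℝ → V :=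
  fun t => π t - sInf ((fun s => αv (π s)) '' Set.Icc 0 t) • α

/-- The composite Pitman transform `P_{α_{s₁}} ∘ ⋯ ∘ P_{α_{s_l}}` along a word
`l = [s₁, …, s_l]` in the generators. -/
noncomputable def pitmanWord {V : Type*} [AddCommGroup V] [Module ℝ V] {B : Type*}
    (α : B → V) (αv : B → Module.Dual ℝ V) (l : List B) : (ℝ → V) → (ℝ → V) :=
  l.foldr (fun s f => pitman (α s) (αv s) ∘ f) id

/-- Littelmann's concatenation of two paths defined on `[0,T]`:
`(π ⋆ η)(t) = π(2t)` for `t ≤ T/2` and `(π ⋆ η)(t) = π(T) + η(2t − T)` for `t ≥ T/2`. -/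
noncomputable def concatPath {V : Type*} [AddCommGroup V] (T : ℝ) (π η : ℝ → V) :
    ℝ → V :=
  fun t => if t ≤ T / 2 then π (2 * t) else π T + η (2 * t - T)


section PitmanAux


open Set

/-- Running infimum. -/
noncomputable def runInf (u : ℝ → ℝ) (t : ℝ) : ℝ := sInf (u '' Icc 0 t)

theorem runInf_neg (u : ℝ → ℝ) {t : ℝ} (ht : t < 0) : runInf u t = 0 := by
  simp [runInf, Icc_eq_empty (not_le.2 ht)]

theorem runInf_congr {u v : ℝ → ℝ} (h : EqOn u v (Ici 0)) : runInf u = runInf v := by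
  funext t
  unfold runInf
  rw [EqOn.image_eq (h.mono Icc_subset_Ici_self)]

theorem runInf_congr_at {u v : ℝ → ℝ} {t : ℝ} (h : EqOn u v (Icc 0 t)) :
    runInf u t = runInf v t := by
  unfold runInf
  rw [EqOn.image_eq h]

theorem runInf_bdd {u : ℝ → ℝ} (hu : ContinuousOn u (Ici 0)) (t : ℝ) :
    BddBelow (u '' Icc 0 t) :=
  (isCompact_Icc.image_of_continuousOn (hu.mono Icc_subset_Ici_self)).bddBelow

theorem runInf_le {u : ℝ → ℝ} (hu : ContinuousOn u (Ici 0)) {s t : ℝ} (hs : 0 ≤ s)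
    (hst : s ≤ t) : runInf u t ≤ u s :=
  csInf_le (runInf_bdd hu t) ⟨s, ⟨hs, hst⟩, rfl⟩

theorem le_runInf {u : ℝ → ℝ} {t x : ℝ} (ht : 0 ≤ t)
    (h : ∀ s, 0 ≤ s → s ≤ t → x ≤ u s) : x ≤ runInf u t := by
  apply le_csInf ((nonempty_Icc.2 ht).image _)
  rintro _ ⟨s, hs, rfl⟩
  exact h s hs.1 hs.2

theorem runInf_attained {u : ℝ → ℝ} (hu : ContinuousOn u (Ici 0)) {t : ℝ} (ht : 0 ≤ t) :
    ∃ s, 0 ≤ s ∧ s ≤ t ∧ runInf u t = u s := by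
  have hc := isCompact_Icc.image_of_continuousOn (hu.mono (show Icc 0 t ⊆ Ici 0 from Icc_subset_Ici_self))
  obtain ⟨s, hs, h⟩ := hc.sInf_mem ((nonempty_Icc.2 ht).image _)
  exact ⟨s, hs.1, hs.2, h.symm⟩

theorem runInf_anti {u : ℝ → ℝ} (hu : ContinuousOn u (Ici 0)) {s t : ℝ} (hs : 0 ≤ s)
    (hst : s ≤ t) : runInf u t ≤ runInf u s :=
  le_runInf hs fun _ h1 h2 => runInf_le hu h1 (h2.trans hst)

theorem runInf_continuousOn {u : ℝ → ℝ} (hu : ContinuousOn u (Ici 0)) :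
    ContinuousOn (runInf u) (Ici 0) := by
  have hv : Continuous fun t => u (max t 0) :=
    hu.comp_continuous (by fun_prop) (fun t => Set.mem_Ici.2 (le_max_right _ _))
  have h : Continuous fun t : ℝ =>
      sInf ((fun x : ℝ => u (max (x * t) 0)) '' Icc (0 : ℝ) 1) := by
    apply IsCompact.continuous_sInf (f := fun (t x : ℝ) => u (max (x * t) 0)) isCompact_Icc
    exact hv.comp (g := fun t => u (max t 0)) (f := fun p : ℝ × ℝ => p.2 * p.1) (by fun_prop)
  refine h.continuousOn.congr ?_
  intro t ht
  have ht : (0:ℝ) ≤ t := ht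
  unfold runInf
  congr 1
  ext y
  constructor
  · rintro ⟨s, ⟨h0, h1⟩, rfl⟩
    rcases eq_or_lt_of_le ht with h | h
    · subst h
      have : s = 0 := le_antisymm h1 h0
      subst this
      exact ⟨0, by simp, by simp⟩
    · refine ⟨s / t, ⟨by positivity, by rw [div_le_one h]; exact h1⟩, ?_⟩
      simp only
      rw [div_mul_cancel₀ _ h.ne', max_eq_left h0]
  · rintro ⟨x, ⟨h0, h1⟩, rfl⟩
    refine ⟨x * t, ⟨by positivity, by nlinarith⟩, ?_⟩
    simp only
    rw [max_eq_left (by positivity)]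

theorem runInf_smul (c : ℝ) (hc : 0 ≤ c) (u : ℝ → ℝ) :
    runInf (fun t => c * u t) = fun t => c * runInf u t := by
  funext t
  have := Real.sInf_smul_of_nonneg hc (u '' Icc 0 t)
  unfold runInf
  rw [← smul_eq_mul, ← this, ← Set.image_smul, Set.image_image]
  simp

theorem runInf_zero_fun : runInf (fun _ => 0) = fun _ => 0 := by
  have := runInf_smul 0 le_rfl (fun _ => 0)
  simpa using this

/-- A level between `runInf u t` and `runInf u r` is hit by `u` while it is at its running infimum. -/
theorem exists_level {u : ℝ → ℝ} (hu : ContinuousOn u (Ici 0)) {r t y : ℝ} (hr : 0 ≤ r)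
    (hrt : r ≤ t) (h1 : runInf u t < y) (h2 : y ≤ runInf u r) :
    ∃ s, r ≤ s ∧ s ≤ t ∧ u s = y ∧ runInf u s = y := by
  obtain ⟨τ, hτ0, hτt, hτ⟩ := runInf_attained hu (hr.trans hrt)
  have hrτ : r ≤ τ := by
    by_contra hcon
    have := runInf_le hu hτ0 (not_le.1 hcon).le
    linarith
  have hcr : ContinuousOn u (Icc r t) := hu.mono fun x hx => hr.trans hx.1
  set K : Set ℝ := {s | s ∈ Icc r t ∧ u s ≤ y} with hK
  have hKc : IsCompact K := by
    have := hcr.preimage_isClosed_of_isClosed isClosed_Icc (isClosed_Iic (a := y))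
    exact isCompact_Icc.of_isClosed_subset this (fun x hx => hx.1)
  obtain ⟨s, hs⟩ := hKc.exists_isLeast ⟨τ, ⟨hrτ, hτt⟩, by linarith⟩
  have hur : y ≤ u r := h2.trans (runInf_le hu hr le_rfl)
  obtain ⟨c, hc, hcy⟩ := intermediate_value_Icc' hs.1.1.1
    (hcr.mono (Icc_subset_Icc_right hs.1.1.2)) ⟨hs.1.2, hur⟩
  have hcs : s ≤ c := hs.2 ⟨⟨hc.1, hc.2.trans hs.1.1.2⟩, hcy.le⟩
  have hcs' : c = s := le_antisymm hc.2 hcs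
  subst hcs'
  refine ⟨c, hc.1, hs.1.1.2, hcy, le_antisymm ?_ ?_⟩
  · rw [← hcy]; exact runInf_le hu (hr.trans hc.1) le_rfl
  · refine le_runInf (hr.trans hc.1) fun x hx0 hxc => ?_
    by_cases hxr : x ≤ r
    · exact h2.trans (runInf_le hu hx0 hxr)
    · by_contra hlt
      have := hs.2 (show x ∈ K from ⟨⟨(not_le.1 hxr).le, hxc.trans hs.1.1.2⟩, (not_le.1 hlt).le⟩)
      have : x = c := le_antisymm hxc this
      subst this
      exact hlt hcy.ge

theorem runInf_key {u n : ℝ → ℝ} (hu : ContinuousOn u (Ici 0)) (hn : ContinuousOn n (Ici 0)) :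
    (fun t => runInf u t + runInf (fun s => u s - 2 * runInf u s + runInf n s) t) =
      runInf (fun s => u s + runInf (fun r => n r - runInf u r) s) := by
  funext t
  rcases lt_or_ge t 0 with ht | ht
  · simp [runInf_neg _ ht]
  have hI := runInf_continuousOn hu
  have hN := runInf_continuousOn hn
  have hnI : ContinuousOn (fun r => n r - runInf u r) (Ici 0) := hn.sub hI
  have hL : ContinuousOn (fun s => u s - 2 * runInf u s + runInf n s) (Ici 0) :=
    (hu.sub (continuousOn_const.mul hI)).add hN
  have hR : ContinuousOn (fun s => u s + runInf (fun r => n r - runInf u r) s) (Ici 0) :=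
    hu.add (runInf_continuousOn hnI)
  apply le_antisymm
  · refine le_runInf ht fun s hs0 hst => ?_
    obtain ⟨r, hr0, hrs, hr⟩ := runInf_attained hnI hs0
    rw [hr]
    have hfin : ∀ s', r ≤ s' → s' ≤ t → u s' - 2 * runInf u s' + runInf u t ≤ u s - runInf u r →
        runInf u t + runInf (fun s => u s - 2 * runInf u s + runInf n s) t
          ≤ u s + (n r - runInf u r) := by
      intro s' h1 h2 h3
      have h4 := runInf_le hL (hr0.trans h1) h2
      have h5 := runInf_le hn hr0 h1
      linarith
    rcases (runInf_anti hu hr0 (hrs.trans hst)).lt_or_eq with h | h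
    · obtain ⟨s', h1, h2, h3, h4⟩ := exists_level hu hr0 (hrs.trans hst) h le_rfl
      refine hfin s' h1 h2 ?_
      have := runInf_le hu hs0 hst
      linarith
    · refine hfin s hrs hst ?_
      have h6 := runInf_anti hu hs0 hst
      have h7 := runInf_anti hu hr0 hrs
      linarith
  · obtain ⟨s, hs0, hst, hs⟩ := runInf_attained hL ht
    rw [hs]
    obtain ⟨r, hr0, hrs, hr⟩ := runInf_attained hn hs0
    rw [hr]
    have hfin : ∀ s', r ≤ s' → s' ≤ t →
        u s' - runInf u r ≤ u s - 2 * runInf u s + runInf u t →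
        runInf (fun s => u s + runInf (fun r => n r - runInf u r) s) t ≤
        runInf u t + (u s - 2 * runInf u s + n r) := by
      intro s' h1 h2 h3
      have h4 := runInf_le hR (hr0.trans h1) h2
      have h5 := runInf_le hnI hr0 h1
      linarith
    have h6 := runInf_anti hu hr0 hrs
    have h7 := runInf_anti hu hs0 hst
    have h8 := runInf_le hu hs0 le_rfl
    rcases (runInf_anti hu hr0 (hrs.trans hst)).lt_or_eq with h | h
    · obtain ⟨τ, hτ0, hτt, hτ⟩ := runInf_attained hu ht
      have hrτ : r ≤ τ := by
        by_contra hcon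
        have := runInf_le hu hτ0 (not_le.1 hcon).le
        linarith
      exact hfin τ hrτ hτt (by linarith)
    · exact hfin s hrs hst (by linarith)

theorem runInf_key_smul {x n : ℝ → ℝ} (hx : ContinuousOn x (Ici 0)) (hn : ContinuousOn n (Ici 0))
    {c : ℝ} (hc : 0 ≤ c) (t : ℝ) :
    c * runInf x t + runInf (fun s => c * (x s - 2 * runInf x s) + runInf n s) t =
      runInf (fun s => c * x s + runInf (fun r => n r - c * runInf x r) s) t := by
  have h := congrFun (runInf_key (u := fun t => c * x t) (continuousOn_const.mul hx) hn) t
  rw [runInf_smul c hc x] at h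
  simp only at h
  rw [← h]
  congr 2
  funext s
  ring

/-- Nested infimum with `j` terms, starting with `x` and coefficients `c i, c (i+1), ...`. -/
noncomputable def chainInf (c : ℕ → ℝ) : ℕ → ℕ → (ℝ → ℝ) → (ℝ → ℝ) → ℝ → ℝ
  | 0, _, _, _ => fun _ => 0
  | j + 1, i, x, y => runInf (fun s => c i * x s + chainInf c j (i + 1) y x s)

theorem chainInf_succ (c : ℕ → ℝ) (j i : ℕ) (x y : ℝ → ℝ) :
    chainInf c (j + 1) i x y = runInf (fun s => c i * x s + chainInf c j (i + 1) y x s) := rfl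

theorem chainInf_continuousOn (c : ℕ → ℝ) (j i : ℕ) {x y : ℝ → ℝ} (hx : ContinuousOn x (Ici 0))
    (hy : ContinuousOn y (Ici 0)) : ContinuousOn (chainInf c j i x y) (Ici 0) := by
  induction j generalizing i x y with
  | zero => exact continuousOn_const
  | succ j ih => exact runInf_continuousOn ((continuousOn_const.mul hx).add (ih _ hy hx))

theorem chainInf_last_zero (c : ℕ → ℝ) (j i : ℕ) (x y : ℝ → ℝ) (h : c (i + j) = 0) :
    chainInf c (j + 1) i x y = chainInf c j i x y := by
  induction j generalizing i x y with
  | zero =>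
    have h : c i = 0 := h
    simp [chainInf, h, runInf_zero_fun]
  | succ j ih =>
    rw [chainInf_succ, ih (i + 1) y x (by rw [← h]; congr 1; ring), chainInf_succ]

theorem chainInf_step (c : ℕ → ℝ) (γ : ℝ) (m : ℕ) (hrec : ∀ i, c (i + 2) = γ * c (i + 1) - c i)
    (hpos : ∀ i < m, 0 ≤ c i) {x y : ℝ → ℝ} (hx : ContinuousOn x (Ici 0))
    (hy : ContinuousOn y (Ici 0)) (p i : ℕ) (hi : i + 2 * p < m) (t : ℝ) :
    c i * runInf x t + chainInf c (2 * p) i (fun s => x s - 2 * runInf x s)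
      (fun s => y s + γ * runInf x s) t = chainInf c (2 * p + 1) i x y t := by
  induction p generalizing i t with
  | zero =>
    simp [chainInf, runInf_smul _ (hpos i (by omega)) x]
  | succ p ih =>
    have hc := hpos i (by omega)
    have key := runInf_key_smul (x := x)
      (n := fun s => c (i + 1) * y s + c i * runInf x s + chainInf c (2 * p + 1) (i + 2) x y s)
      hx (((continuousOn_const.mul hy).add (continuousOn_const.mul (runInf_continuousOn hx))).add
        (chainInf_continuousOn _ _ _ hx hy)) hc t
    rw [show 2 * (p + 1) = 2 * p + 1 + 1 from by ring]
    rw [chainInf_succ, chainInf_succ, chainInf_succ c (2 * p + 1 + 1), chainInf_succ c (2 * p + 1)]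
    convert key using 5
    · congr 1
      funext s
      rw [← ih (i + 2) (by omega) s, hrec]
      ring
    · congr 1
      funext s
      ring

theorem chainInf_step' (c : ℕ → ℝ) (γ : ℝ) (m : ℕ) (hc0 : c 0 = 1) (hc1 : c 1 = γ)
    (hrec : ∀ i, c (i + 2) = γ * c (i + 1) - c i)
    (hpos : ∀ i < m, 0 ≤ c i) {x y : ℝ → ℝ} (hx : ContinuousOn x (Ici 0))
    (hy : ContinuousOn y (Ici 0)) (p : ℕ) (hi : 1 + 2 * p < m) :
    chainInf c (2 * p + 1) 0 (fun s => y s + γ * runInf x s) (fun s => x s - 2 * runInf x s)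
       = chainInf c (2 * p + 2) 0 y x := by
  rw [chainInf_succ, chainInf_succ c (2 * p + 1)]
  congr 1
  funext s
  rw [← chainInf_step c γ m hrec hpos hx hy p (0 + 1) (by omega) s, hc0]
  simp only [Nat.zero_add, hc1]
  ring

section Path

variable {V : Type*} [NormedAddCommGroup V] [NormedSpace ℝ V] [FiniteDimensional ℝ V]

theorem dual_continuousOn (f : Module.Dual ℝ V) {π : ℝ → V} {S : Set ℝ} (h : ContinuousOn π S) :
    ContinuousOn (fun t => f (π t)) S :=
  (LinearMap.continuous_of_finiteDimensional f).comp_continuousOn h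

theorem pitman_eq {V : Type*} [AddCommGroup V] [Module ℝ V] (α : V) (αv : Module.Dual ℝ V) (π : ℝ → V) (t : ℝ) :
    pitman α αv π t = π t - runInf (fun s => αv (π s)) t • α := rfl

theorem pitman_continuousOn (α : V) (αv : Module.Dual ℝ V) {π : ℝ → V}
    (h : ContinuousOn π (Ici 0)) : ContinuousOn (pitman α αv π) (Ici 0) :=
  h.sub ((runInf_continuousOn (dual_continuousOn αv h)).smul continuousOn_const)

theorem pitman_rescale (α : V) (αv : Module.Dual ℝ V) (κ : ℝ) (hκ : 0 < κ) :
    pitman (κ • α) (κ⁻¹ • αv) = pitman α αv := by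
  funext π t
  rw [pitman_eq, pitman_eq]
  have := congrFun (runInf_smul κ⁻¹ (inv_nonneg.2 hκ.le) (fun s => αv (π s))) t
  simp only [LinearMap.smul_apply, smul_eq_mul]
  rw [this, smul_smul]
  congr 2
  field_simp

/-- alternating composition of `k` operators, innermost is `Q` -/
def altComp {X : Type*} (P Q : X → X) : ℕ → X → X
  | 0 => id
  | k + 1 => fun x => altComp Q P k (Q x)

theorem altComp_succ {X : Type*} (P Q : X → X) (k : ℕ) (x : X) :
    altComp P Q (k + 1) x = altComp Q P k (Q x) := rfl

theorem altComp_formula (c : ℕ → ℝ) (γ : ℝ) (m : ℕ) (hc0 : c 0 = 1) (hc1 : c 1 = γ)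
    (hrec : ∀ i, c (i + 2) = γ * c (i + 1) - c i) (hpos : ∀ i < m, 0 ≤ c i)
    (k : ℕ) (hk : k ≤ m) (α β : V) (αv βv : Module.Dual ℝ V) (hα : αv α = 2) (hβ : βv β = 2)
    (hαβ : αv β = -γ) (hβα : βv α = -γ) (π : ℝ → V) (hπ : ContinuousOn π (Ici 0)) (t : ℝ) :
    altComp (pitman α αv) (pitman β βv) k π t =
      π t - (chainInf c (if Even k then k else k - 1) 0 (fun s => αv (π s)) (fun s => βv (π s)) t) • α
       - (chainInf c (if Even k then k - 1 else k) 0 (fun s => βv (π s)) (fun s => αv (π s)) t) • β := by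
  induction k generalizing α β αv βv π t with
  | zero => simp [altComp, chainInf]
  | succ k ih =>
    have hx := dual_continuousOn αv hπ
    have hy := dual_continuousOn βv hπ
    have e1 : (fun s => αv (pitman β βv π s)) =
        fun s => (fun s => αv (π s)) s + γ * runInf (fun s => βv (π s)) s := by
      funext s; simp [pitman_eq, hαβ]; ring
    have e2 : (fun s => βv (pitman β βv π s)) =
        fun s => (fun s => βv (π s)) s - 2 * runInf (fun s => βv (π s)) s := by
      funext s; simp [pitman_eq, hβ]; ring
    rw [altComp_succ, ih (by omega) β α βv αv hβ hα hβα hαβ _ (pitman_continuousOn β βv hπ) t,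
      e1, e2, pitman_eq]
    rcases Nat.even_or_odd' k with ⟨p, rfl | rfl⟩
    · have h1 := chainInf_step c γ m hrec hpos hy hx p 0 (by omega) t
      have h2 : chainInf c (2 * p - 1) 0
          (fun s => (fun s => αv (π s)) s + γ * runInf (fun s => βv (π s)) s)
          (fun s => (fun s => βv (π s)) s - 2 * runInf (fun s => βv (π s)) s) =
          chainInf c (2 * p) 0 (fun s => αv (π s)) (fun s => βv (π s)) := by
        rcases p with _ | p
        · rfl
        · exact chainInf_step' c γ m hc0 hc1 hrec hpos hy hx p (by omega)
      rw [hc0, one_mul] at h1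
      have hev : Even (2 * p) := even_two_mul p
      have hodd : ¬ Even (2 * p + 1) := by simp
      rw [if_pos hev, if_pos hev, if_neg hodd, if_neg hodd, h2, ← h1, Nat.add_sub_cancel, add_smul]
      abel
    · have h1 := chainInf_step c γ m hrec hpos hy hx p 0 (by omega) t
      have h2 := chainInf_step' c γ m hc0 hc1 hrec hpos hy hx p (by omega)
      rw [hc0, one_mul] at h1
      have hodd : ¬ Even (2 * p + 1) := by simp
      have hev : Even (2 * p + 1 + 1) := by simp [Nat.even_add_one]
      rw [if_neg hodd, if_neg hodd, if_pos hev, if_pos hev, h2, Nat.add_sub_cancel,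
        Nat.add_sub_cancel, ← h1, add_smul]
      abel

theorem altComp_braid (m : ℕ) (hm : 2 ≤ m) (γ : ℝ) (hγ : γ = 2 * Real.cos (Real.pi / m))
    (α β : V) (αv βv : Module.Dual ℝ V) (hα : αv α = 2) (hβ : βv β = 2)
    (hαβ : αv β = -γ) (hβα : βv α = -γ) (π : ℝ → V) (hπ : ContinuousOn π (Ici 0)) (t : ℝ) :
    altComp (pitman α αv) (pitman β βv) m π t = altComp (pitman β βv) (pitman α αv) m π t := by
  have hm0 : (0 : ℝ) < m := by exact_mod_cast (by omega : 0 < m)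
  have hm2 : (2 : ℝ) ≤ m := by exact_mod_cast hm
  set θ : ℝ := Real.pi / m with hθ
  have hθ0 : 0 < θ := div_pos Real.pi_pos hm0
  have hmθ : m * θ = Real.pi := by rw [hθ]; field_simp
  have hsin : 0 < Real.sin θ := Real.sin_pos_of_pos_of_lt_pi hθ0 (by nlinarith)
  set c : ℕ → ℝ := fun i => Real.sin ((i + 1) * θ) / Real.sin θ with hc
  have hc0 : c 0 = 1 := by simp [hc, hsin.ne']
  have hc1 : c 1 = γ := by
    simp only [hc, Nat.cast_one]
    rw [show ((1 : ℝ) + 1) * θ = 2 * θ by ring, Real.sin_two_mul, hγ]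
    field_simp
  have hrec : ∀ i, c (i + 2) = γ * c (i + 1) - c i := by
    intro i
    simp only [hc]
    push_cast
    rw [show ((i : ℝ) + 2 + 1) * θ = (i + 1 + 1) * θ + θ by ring,
      show ((i : ℝ) + 1) * θ = (i + 1 + 1) * θ - θ by ring, Real.sin_add, Real.sin_sub, hγ]
    field_simp
    ring
  have hpos : ∀ i < m, 0 ≤ c i := by
    intro i hi
    have : ((i : ℝ) + 1) ≤ m := by exact_mod_cast hi
    exact div_nonneg (Real.sin_nonneg_of_nonneg_of_le_pi (by positivity) (by nlinarith)) hsin.le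
  have hlast : c (m - 1) = 0 := by
    simp only [hc]
    rw [Nat.cast_sub (by omega)]
    simp [hmθ]
  obtain ⟨n, rfl⟩ : ∃ n, m = n + 1 := ⟨m - 1, by omega⟩
  have hl : ∀ x y, chainInf c (n + 1) 0 x y = chainInf c n 0 x y := fun x y =>
    chainInf_last_zero c n 0 x y (by simpa using hlast)
  rw [altComp_formula c γ (n+1) hc0 hc1 hrec hpos (n+1) le_rfl α β αv βv hα hβ hαβ hβα π hπ t,
    altComp_formula c γ (n+1) hc0 hc1 hrec hpos (n+1) le_rfl β α βv αv hβ hα hβα hαβ π hπ t]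
  by_cases h : Even (n + 1)
  · simp only [if_pos h, Nat.add_sub_cancel, hl]
    abel
  · simp only [if_neg h, Nat.add_sub_cancel, hl]
    abel

end Path

section Cox

variable {B W : Type*} [Group W] {M : CoxeterMatrix B} (cs : CoxeterSystem M W)

open CoxeterSystem

open Classical in
/-- The involution `(x, ε) ↦ (s x s, ε + [x = s])`. -/
noncomputable def refPerm (s : W) (hs : s * s = 1) : Equiv.Perm (W × ZMod 2) where
  toFun p := (s * p.1 * s, p.2 + if p.1 = s then 1 else 0)
  invFun p := (s * p.1 * s, p.2 + if p.1 = s then 1 else 0)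
  left_inv := by
    rintro ⟨x, ε⟩
    have h1 : s * x * s = s ↔ x = s := by
      constructor
      · intro h
        have : s * (s * x * s) * s = s * s * s := by rw [h]
        simpa [mul_assoc, hs, ← mul_assoc s s] using this
      · rintro rfl; simp [hs]
    have h2 : s * (s * x * s) * s = x := by
      simp [mul_assoc, hs, ← mul_assoc s s]
    simp only [h1, h2, Prod.mk.injEq, true_and]
    split_ifs
    · rw [add_assoc]; simp [show (1 + 1 : ZMod 2) = 0 from rfl]
    · simp
  right_inv := by
    rintro ⟨x, ε⟩
    have h1 : s * x * s = s ↔ x = s := by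
      constructor
      · intro h
        have : s * (s * x * s) * s = s * s * s := by rw [h]
        simpa [mul_assoc, hs, ← mul_assoc s s] using this
      · rintro rfl; simp [hs]
    have h2 : s * (s * x * s) * s = x := by
      simp [mul_assoc, hs, ← mul_assoc s s]
    simp only [h1, h2, Prod.mk.injEq, true_and]
    split_ifs
    · rw [add_assoc]; simp [show (1 + 1 : ZMod 2) = 0 from rfl]
    · simp

open Classical in
theorem refPerm_apply (s : W) (hs : s * s = 1) (x : W) (ε : ZMod 2) :
    refPerm s hs (x, ε) = (s * x * s, ε + if x = s then 1 else 0) := rfl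

/-- `r⁻ᵏ t rᵏ = t r²ᵏ` for `r = s t`. -/
theorem dihedral_conj {s t : W} (hs : s * s = 1) (ht : t * t = 1) (k : ℕ) :
    t * (s * t) ^ k = ((s * t) ^ k)⁻¹ * t := by
  induction k with
  | zero => simp
  | succ k ih =>
    have hs' : s⁻¹ = s := inv_eq_of_mul_eq_one_left hs
    have ht' : t⁻¹ = t := inv_eq_of_mul_eq_one_left ht
    rw [pow_succ, ← mul_assoc, ih, ← pow_succ, pow_succ', mul_inv_rev, mul_inv_rev, hs', ht']
    simp only [mul_assoc]

open Classical in
theorem refPerm_pow {s t : W} (hs : s * s = 1) (ht : t * t = 1) (n : ℕ) (x : W) (ε : ZMod 2) :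
    ((refPerm s hs * refPerm t ht) ^ n) (x, ε) =
      ((s * t) ^ n * x * ((s * t) ^ n)⁻¹,
        ε + ∑ j ∈ Finset.range (2 * n), if x = t * (s * t) ^ j then 1 else 0) := by
  have hs' : s⁻¹ = s := inv_eq_of_mul_eq_one_left hs
  have ht' : t⁻¹ = t := inv_eq_of_mul_eq_one_left ht
  induction n with
  | zero => simp
  | succ n ih =>
    rw [pow_succ', Equiv.Perm.mul_apply, ih, Equiv.Perm.mul_apply, refPerm_apply, refPerm_apply,
      show 2 * (n + 1) = 2 * n + 1 + 1 by ring, Finset.sum_range_succ, Finset.sum_range_succ]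
    have e1 : (s * t) ^ n * x * ((s * t) ^ n)⁻¹ = t ↔ x = t * (s * t) ^ (2 * n) := by
      rw [two_mul, pow_add, ← mul_assoc, dihedral_conj hs ht, mul_inv_eq_iff_eq_mul,
        ← eq_inv_mul_iff_mul_eq, mul_assoc]
    have e2 : t * ((s * t) ^ n * x * ((s * t) ^ n)⁻¹) * t = s ↔ x = t * (s * t) ^ (2 * n + 1) := by
      have : t * (s * t) ^ (2 * n + 1) = ((s * t) ^ n)⁻¹ * (t * s * t) * (s * t) ^ n := by
        rw [show 2 * n + 1 = n + (1 + n) by ring, pow_add, pow_add, ← mul_assoc,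
          dihedral_conj hs ht]
        simp [mul_assoc]
      rw [this]
      clear this e1 ih
      generalize (s * t) ^ n = g
      constructor
      · intro h
        rw [← h]
        have : t * (t * (g * x * (g)⁻¹) * t) * t =
            (t * t) * (g * x * (g)⁻¹) * (t * t) := by simp only [mul_assoc]
        rw [this, ht]
        group
      · rintro rfl
        have : t * (g * ((g)⁻¹ * (t * s * t) * g) * (g)⁻¹) * t
            = (t * t) * s * (t * t) := by group
        rw [this, ht]
        simp
    simp only [e1, e2]
    refine Prod.ext ?_ ?_
    · simp only [pow_succ', mul_inv_rev, hs', ht', mul_assoc]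
    · simp only [add_assoc]

theorem simple_sq (i : B) : cs.simple i * cs.simple i = 1 := cs.simple_mul_simple_self i

theorem refPerm_liftable :
    M.IsLiftable (fun i => refPerm (cs.simple i) (simple_sq cs i)) := by
  classical
  intro i j
  ext1 p
  obtain ⟨x, ε⟩ := p
  rw [refPerm_pow, cs.simple_mul_simple_pow]
  simp only [one_mul, inv_one, mul_one, Equiv.Perm.coe_one, id_eq, Prod.mk.injEq, true_and]
  rw [two_mul, Finset.sum_range_add]
  simp only [pow_add, cs.simple_mul_simple_pow, one_mul]
  rw [CharTwo.add_self_eq_zero, add_zero]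

/-- The reflection cocycle homomorphism. -/
noncomputable def refHom : W →* Equiv.Perm (W × ZMod 2) := cs.lift ⟨_, refPerm_liftable cs⟩

theorem refHom_simple (i : B) :
    refHom cs (cs.simple i) = refPerm (cs.simple i) (simple_sq cs i) :=
  cs.lift_apply_simple (refPerm_liftable cs) i

open Classical in
theorem refHom_word (ω : List B) (x : W) :
    refHom cs (cs.wordProd ω) (x, 0) =
      (cs.wordProd ω * x * (cs.wordProd ω)⁻¹, ((cs.rightInvSeq ω).count x : ZMod 2)) := by
  induction ω with
  | nil => simp
  | cons i ω ih =>
    rw [cs.wordProd_cons, map_mul, Equiv.Perm.mul_apply, ih, refHom_simple, refPerm_apply,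
      rightInvSeq, List.count_cons]
    refine Prod.ext ?_ ?_
    · simp [mul_assoc]
    · simp only [beq_iff_eq]
      push_cast
      congr 1
      have : cs.wordProd ω * x * (cs.wordProd ω)⁻¹ = cs.simple i ↔
        (cs.wordProd ω)⁻¹ * cs.simple i * cs.wordProd ω = x := by
        rw [mul_inv_eq_iff_eq_mul, ← eq_inv_mul_iff_mul_eq, mul_assoc, eq_comm]
      simp only [this]

theorem mem_ris_of_eq {ω ω' : List B} (h : cs.wordProd ω = cs.wordProd ω')
    (hnd : (cs.rightInvSeq ω).Nodup) {x : W} (hx : x ∈ cs.rightInvSeq ω) :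
    x ∈ cs.rightInvSeq ω' := by
  classical
  have h1 := congrArg Prod.snd (refHom_word cs ω x)
  have h2 := congrArg Prod.snd (refHom_word cs ω' x)
  rw [h] at h1
  rw [h1] at h2
  simp only [List.count_eq_one_of_mem hnd hx] at h2
  by_contra hcon
  rw [List.count_eq_zero_of_not_mem hcon] at h2
  simp at h2

theorem isReduced_of_nodup {ω : List B} (hnd : (cs.rightInvSeq ω).Nodup) : cs.IsReduced ω := by
  classical
  obtain ⟨ω', hr, he⟩ := cs.exists_isReduced (cs.wordProd ω)
  refine le_antisymm (cs.length_wordProd_le ω) ?_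
  have : (cs.rightInvSeq ω).length ≤ (cs.rightInvSeq ω').length :=
    (hnd.subperm fun x hx => mem_ris_of_eq cs he hnd hx).length_le
  rw [length_rightInvSeq, length_rightInvSeq] at this
  rw [he, hr.eq]
  exact this

theorem exchange {ω : List B} {i : B} (h : cs.IsRightDescent (cs.wordProd ω) i) :
    ∃ j < ω.length, cs.wordProd ω * cs.simple i = cs.wordProd (ω.eraseIdx j) := by
  obtain ⟨ω', hr, he⟩ := cs.exists_isReduced (cs.wordProd ω * cs.simple i)
  have hprod : cs.wordProd (ω'.concat i) = cs.wordProd ω := by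
    rw [cs.wordProd_concat, ← he]; simp
  have hred : cs.IsReduced (ω'.concat i) := by
    rw [CoxeterSystem.IsReduced, hprod, List.length_concat, ← hr.eq, ← he]
    exact (cs.isRightDescent_iff.1 h).symm
  have hmem : cs.simple i ∈ cs.rightInvSeq ω :=
    mem_ris_of_eq cs hprod hred.nodup_rightInvSeq (by rw [rightInvSeq_concat]; simp)
  obtain ⟨j, hj, hj'⟩ := List.mem_iff_getElem.1 hmem
  refine ⟨j, by simpa using hj, ?_⟩
  rw [← cs.wordProd_mul_getD_rightInvSeq, List.getD_eq_getElem _ _ hj, hj']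

theorem ris_alternating_aux (s t : B) (m : ℕ) :
    (cs.wordProd (alternatingWord s t m))⁻¹ * cs.simple (if Even m then t else s) *
      cs.wordProd (alternatingWord s t m) =
      cs.simple t * (cs.simple s * cs.simple t) ^ m := by
  rw [cs.prod_alternatingWord_eq_mul_pow]
  have hd := dihedral_conj (simple_sq cs s) (simple_sq cs t)
  rcases Nat.even_or_odd' m with ⟨p, rfl | rfl⟩
  · rw [if_pos (even_two_mul p), if_pos (even_two_mul p), Nat.mul_div_cancel_left _ two_pos,
      two_mul, pow_add, ← mul_assoc (cs.simple t), hd, one_mul]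
  · have hodd : ¬ Even (2 * p + 1) := by simp
    rw [if_neg hodd, if_neg hodd, show (2 * p + 1) / 2 = p by omega,
      show 2 * p + 1 = p + (1 + p) by ring, pow_add, pow_add, mul_inv_rev, cs.inv_simple, ← hd p]
    simp [mul_assoc]

theorem ris_alternating (s t : B) (m : ℕ) (hm : m ≤ orderOf (cs.simple s * cs.simple t)) :
    (cs.rightInvSeq (alternatingWord s t m)).Nodup ∧
    ∀ x ∈ cs.rightInvSeq (alternatingWord s t m),
      ∃ j < m, x = cs.simple t * (cs.simple s * cs.simple t) ^ j := by
  induction m with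
  | zero => simp [alternatingWord]
  | succ m ih =>
    obtain ⟨h1, h2⟩ := ih (by omega)
    rw [alternatingWord_succ', rightInvSeq, ris_alternating_aux]
    refine ⟨List.nodup_cons.2 ⟨fun hmem => ?_, h1⟩, ?_⟩
    · obtain ⟨j, hj, he⟩ := h2 _ hmem
      have := pow_injOn_Iio_orderOf (x := cs.simple s * cs.simple t)
        (show m ∈ Set.Iio _ from hm) (show j ∈ Set.Iio _ from by simp; omega) (mul_left_cancel he)
      omega
    · intro x hx
      rcases List.mem_cons.1 hx with rfl | hx
      · exact ⟨m, by omega, rfl⟩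
      · obtain ⟨j, hj, he⟩ := h2 x hx
        exact ⟨j, by omega, he⟩

theorem isReduced_alternating (s t : B) (m : ℕ)
    (hm : m ≤ orderOf (cs.simple s * cs.simple t)) : cs.IsReduced (alternatingWord s t m) :=
  isReduced_of_nodup cs (ris_alternating cs s t m hm).1

theorem dihedral_suffix (w : W) (m k : ℕ) (hk : k ≤ m) (s t : B)
    (hst : m ≤ orderOf (cs.simple s * cs.simple t))
    (hts : m ≤ orderOf (cs.simple t * cs.simple s))
    (hs : cs.IsRightDescent w s) (ht : cs.IsRightDescent w t) :
    ∃ ω : List B, cs.wordProd (ω ++ alternatingWord s t k) = w ∧ ω.length + k = cs.length w := by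
  induction k generalizing s t with
  | zero =>
    obtain ⟨ω, h1, h2⟩ := cs.exists_isReduced w
    exact ⟨ω, by simp [alternatingWord, h2], by rw [h2, h1.eq]; rfl⟩
  | succ k ih =>
    obtain ⟨ω, h1, h2⟩ := ih (by omega) t s hts hst ht hs
    subst h1
    obtain ⟨j, hj, he⟩ := exchange cs ht
    have hw : cs.wordProd (ω ++ alternatingWord t s k) =
      cs.wordProd ((ω ++ alternatingWord t s k).eraseIdx j) * cs.simple t := by
      rw [← he]; simp
    by_cases hjω : j < ω.length
    · rw [List.eraseIdx_append_of_lt_length hjω] at hw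
      refine ⟨ω.eraseIdx j, ?_, ?_⟩
      · rw [hw, alternatingWord_succ, cs.wordProd_append, cs.wordProd_append, cs.wordProd_concat,
          mul_assoc]
      · have := List.length_eraseIdx_add_one hjω
        omega
    · exfalso
      push Not at hjω
      rw [List.eraseIdx_append_of_length_le hjω, cs.wordProd_append, cs.wordProd_append,
        mul_assoc, mul_right_inj] at he
      have hr := isReduced_alternating cs s t (k + 1) (by omega)
      rw [CoxeterSystem.IsReduced, length_alternatingWord, alternatingWord_succ,
        cs.wordProd_concat, he] at hr
      have h3 := cs.length_wordProd_le ((alternatingWord t s k).eraseIdx (j - ω.length))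
      have h4 := List.length_eraseIdx_le (alternatingWord t s k) (j - ω.length)
      rw [length_alternatingWord] at h4
      omega

theorem matsumoto (hord : ∀ s t : B, s ≠ t → 0 < M s t ∧ orderOf (cs.simple s * cs.simple t) = M s t)
    (R : List B → List B → Prop) (hrefl : ∀ l, R l l)
    (htrans : ∀ l l' l'', R l l' → R l' l'' → R l l'')
    (hright : ∀ l l' s, R l l' → R (l.concat s) (l'.concat s))
    (hbraid : ∀ s t, s ≠ t → ∀ l, R (l ++ alternatingWord s t (M s t)) (l ++ alternatingWord t s (M s t)))
    (n : ℕ) (l l' : List B) (hn : l.length = n) (hl : cs.IsReduced l) (hl' : cs.IsReduced l')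
    (he : cs.wordProd l = cs.wordProd l') : R l l' := by
  induction n generalizing l l' with
  | zero =>
    have h2 : l'.length = 0 := by rw [← hl'.eq, ← he, hl.eq, hn]
    rw [List.length_eq_zero_iff.1 hn, List.length_eq_zero_iff.1 h2]
    exact hrefl _
  | succ n ih =>
    have hn' : l'.length = n + 1 := by rw [← hl'.eq, ← he, hl.eq, hn]
    -- removing the last letter
    have hred : ∀ (u : List B) (s : B), cs.IsReduced (u.concat s) → cs.IsReduced u := by
      intro u s h
      have := h.take u.length
      simpa using this
    have hdesc : ∀ (u : List B) (s : B), cs.IsReduced (u.concat s) →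
        cs.IsRightDescent (cs.wordProd (u.concat s)) s := by
      intro u s h
      rw [cs.isRightDescent_iff, h.eq, List.length_concat, ← (hred u s h).eq, cs.wordProd_concat]
      simp
    obtain ⟨u, s, rfl⟩ : ∃ (u : List B) (s : B), l = u.concat s := by
      rcases List.eq_nil_or_concat l with h | h
      · simp [h] at hn
      · simpa using h
    obtain ⟨v, t, rfl⟩ : ∃ (u : List B) (s : B), l' = u.concat s := by
      rcases List.eq_nil_or_concat l' with h | h
      · simp [h] at hn'
      · simpa using h
    rw [List.length_concat] at hn hn'
    by_cases hst : s = t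
    · subst hst
      rw [cs.wordProd_concat, cs.wordProd_concat, mul_left_inj] at he
      exact hright _ _ _ (ih u v (by omega) (hred _ _ hl) (hred _ _ hl') he)
    · obtain ⟨hpos, hord1⟩ := hord s t hst
      obtain ⟨_, hord2⟩ := hord t s (Ne.symm hst)
      have hsym : M t s = M s t := M.symmetric t s
      set m := M s t with hm
      obtain ⟨ω, h1, h2⟩ := dihedral_suffix cs (cs.wordProd (u.concat s)) m m le_rfl t s
        (by omega) (by omega) (by rw [he]; exact hdesc v t hl') (hdesc u s hl)
      rw [hl.eq, List.length_concat] at h2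
      have hbp : cs.wordProd (alternatingWord s t m) = cs.wordProd (alternatingWord t s m) := by
        have := cs.wordProd_braidWord_eq s t
        rw [braidWord, braidWord, hsym] at this
        exact this
      obtain ⟨q, hq⟩ : ∃ q, m = q + 1 := ⟨m - 1, by omega⟩
      have key : ∀ (a b : B) (x : List B), cs.IsReduced (x.concat b) → x.length = n →
          cs.wordProd (x.concat b) = cs.wordProd (ω ++ alternatingWord a b m) →
          cs.IsReduced (ω ++ alternatingWord b a q) ∧
          cs.wordProd x = cs.wordProd (ω ++ alternatingWord b a q) := by
        intro a b x hx hxn hxe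
        have e : cs.wordProd x = cs.wordProd (ω ++ alternatingWord b a q) := by
          rw [hq, alternatingWord_succ, cs.wordProd_append, cs.wordProd_concat, cs.wordProd_concat,
            ← mul_assoc, mul_left_inj] at hxe
          rw [hxe, cs.wordProd_append]
        refine ⟨?_, e⟩
        rw [CoxeterSystem.IsReduced, ← e, (hred _ _ hx).eq, List.length_append, length_alternatingWord]
        omega
      obtain ⟨r1, e1⟩ := key t s u hl (by omega) h1.symm
      obtain ⟨r2, e2⟩ := key s t v hl' (by omega) (by
        rw [← he, ← h1, cs.wordProd_append, cs.wordProd_append, hbp])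
      have R1 := hright _ _ s (ih u _ (by omega) (hred _ _ hl) r1 e1)
      have R2 := hright _ _ t (ih _ v (by rw [List.length_append, length_alternatingWord]; omega)
        r2 (hred _ _ hl') e2.symm)
      have hcat : ∀ a b : B, (ω ++ alternatingWord b a q).concat b = ω ++ alternatingWord a b m := by
        intro a b
        rw [hq, alternatingWord_succ]
        simp
      rw [hcat] at R1 R2
      have R3 := hbraid t s (Ne.symm hst) ω
      rw [hsym] at R3
      exact htrans _ _ _ R1 (htrans _ _ _ R3 R2)

end Cox

section Order

variable {V : Type*} [AddCommGroup V] [Module ℝ V]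
    {B : Type*} {W : Type*} [Group W]
    {M : CoxeterMatrix B}



theorem rho_mul
    (cs : CoxeterSystem M W) (α : B → V) (αv : B → Module.Dual ℝ V)
    (_hpair : ∀ s, αv s (α s) = 2) (ρ : W →* (V ≃ₗ[ℝ] V))
    (hρs : ∀ s v, ρ (cs.simple s) v = v - αv s v • α s)
    (s t : B) (v : V) : ρ (cs.simple s * cs.simple t) v =
    v - αv t v • α t - (αv s v - αv t v * αv s (α t)) • α s := by
  rw [map_mul, LinearEquiv.mul_apply, hρs, hρs]
  simp

theorem rho_mul_self
    (cs : CoxeterSystem M W) (α : B → V) (αv : B → Module.Dual ℝ V)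
    (hpair : ∀ s, αv s (α s) = 2) (ρ : W →* (V ≃ₗ[ℝ] V))
    (hρs : ∀ s v, ρ (cs.simple s) v = v - αv s v • α s)
    (s t : B) : ρ (cs.simple s * cs.simple t) (α s) =
    (αv s (α t) * αv t (α s) - 1) • α s - αv t (α s) • α t := by
  rw [rho_mul cs α αv hpair ρ hρs, hpair]
  module

theorem rho_mul_other
    (cs : CoxeterSystem M W) (α : B → V) (αv : B → Module.Dual ℝ V)
    (hpair : ∀ s, αv s (α s) = 2) (ρ : W →* (V ≃ₗ[ℝ] V))
    (hρs : ∀ s v, ρ (cs.simple s) v = v - αv s v • α s)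
    (s t : B) : ρ (cs.simple s * cs.simple t) (α t) =
    αv s (α t) • α s - α t := by
  rw [rho_mul cs α αv hpair ρ hρs, hpair]
  module

theorem rho_rec
    (cs : CoxeterSystem M W) (α : B → V) (αv : B → Module.Dual ℝ V)
    (hpair : ∀ s, αv s (α s) = 2) (ρ : W →* (V ≃ₗ[ℝ] V))
    (hρs : ∀ s v, ρ (cs.simple s) v = v - αv s v • α s)
    (s t : B) (k : ℕ) : ρ ((cs.simple s * cs.simple t) ^ (k + 2)) (α s) =
    (αv s (α t) * αv t (α s) - 2) • ρ ((cs.simple s * cs.simple t) ^ (k + 1)) (α s)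
      - ρ ((cs.simple s * cs.simple t) ^ k) (α s) := by
  have h : ρ (cs.simple s * cs.simple t) (ρ (cs.simple s * cs.simple t) (α s)) =
      (αv s (α t) * αv t (α s) - 2) • ρ (cs.simple s * cs.simple t) (α s) - α s := by
    rw [rho_mul_self cs α αv hpair ρ hρs, map_sub, map_smul, map_smul,
      rho_mul_self cs α αv hpair ρ hρs, rho_mul_other cs α αv hpair ρ hρs]
    module
  generalize cs.simple s * cs.simple t = g at h ⊢
  rw [pow_succ, pow_succ, mul_assoc, map_mul, map_mul, LinearEquiv.mul_apply,
    LinearEquiv.mul_apply, h, map_sub, map_smul, map_mul, LinearEquiv.mul_apply]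

theorem rho_cos
    (cs : CoxeterSystem M W) (α : B → V) (αv : B → Module.Dual ℝ V)
    (hpair : ∀ s, αv s (α s) = 2) (ρ : W →* (V ≃ₗ[ℝ] V))
    (hρs : ∀ s v, ρ (cs.simple s) v = v - αv s v • α s)
    (s t : B) (θ : ℝ) (hθ : αv s (α t) * αv t (α s) = 4 * Real.cos θ ^ 2) (k : ℕ) :
    αv s (ρ ((cs.simple s * cs.simple t) ^ k) (α s)) = 2 * Real.cos (2 * k * θ) ∧
    αv s (ρ ((cs.simple s * cs.simple t) ^ (k + 1)) (α s)) = 2 * Real.cos (2 * (k + 1) * θ) := by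
  induction k with
  | zero =>
    refine ⟨by simp [hpair], ?_⟩
    rw [zero_add, pow_one, rho_mul_self cs α αv hpair ρ hρs]
    simp only [map_sub, map_smul, smul_eq_mul, hpair, Nat.cast_zero, zero_add, mul_one,
      Real.cos_two_mul]
    linear_combination hθ
  | succ k ih =>
    obtain ⟨h1, h2⟩ := ih
    refine ⟨by push_cast; exact h2, ?_⟩
    rw [rho_rec cs α αv hpair ρ hρs, map_sub, map_smul, h1, h2, hθ, smul_eq_mul]
    push_cast
    have e1 : 2 * ((k : ℝ) + 1 + 1) * θ = 2 * (k + 1) * θ + 2 * θ := by ring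
    have e2 : 2 * (k : ℝ) * θ = 2 * (k + 1) * θ - 2 * θ := by ring
    rw [e1, e2, Real.cos_add, Real.cos_sub, Real.cos_two_mul θ]
    ring

theorem order_ne_zero [Finite W]
    (cs : CoxeterSystem M W) (α : B → V) (αv : B → Module.Dual ℝ V)
    (hpair : ∀ s, αv s (α s) = 2) (ρ : W →* (V ≃ₗ[ℝ] V))
    (hρs : ∀ s v, ρ (cs.simple s) v = v - αv s v • α s)
    (hρinj : Function.Injective ρ)
    (hM : ∀ s s' : B, s ≠ s' →
      (M s s' = 2 ∧ αv s (α s') = 0 ∧ αv s' (α s) = 0) ∨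
      (αv s (α s') < 0 ∧ αv s' (α s) < 0 ∧
        αv s (α s') * αv s' (α s) = 4 * Real.cos (Real.pi / (M s s' : ℝ)) ^ 2))
    (s t : B) (hst : s ≠ t) : M s t ≠ 0 := by
  classical
  intro h0
  rcases hM s t hst with h | ⟨hx, hy, hxy⟩
  · omega
  rw [h0] at hxy
  simp only [Nat.cast_zero, div_zero, Real.cos_zero, one_pow, mul_one] at hxy
  set g := cs.simple s * cs.simple t with hg
  set n := orderOf g with hn
  have hnpos : (0 : ℝ) < n := by exact_mod_cast orderOf_pos g
  have hgn : g ^ n = 1 := pow_orderOf_eq_one g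
  -- the orbit of `α s` grows linearly
  have hlin : ∀ k : ℕ, ρ (g ^ k) (α s) = α s + (k : ℝ) • (ρ g (α s) - α s) ∧
      ρ (g ^ (k + 1)) (α s) = α s + ((k : ℝ) + 1) • (ρ g (α s) - α s) := by
    intro k
    induction k with
    | zero => simp
    | succ k ih =>
      refine ⟨by push_cast; exact ih.2, ?_⟩
      rw [rho_rec cs α αv hpair ρ hρs, ih.1, ih.2, hxy]
      push_cast
      module
  have h1 := (hlin n).1
  rw [hgn] at h1
  have h2 : ρ g (α s) - α s = 0 := by
    have : (n : ℝ) • (ρ g (α s) - α s) = 0 := by simpa using h1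
    exact (smul_eq_zero.1 this).resolve_left hnpos.ne'
  rw [hg, rho_mul_self cs α αv hpair ρ hρs, hxy] at h2
  -- proportionality
  have hprop : αv t (α s) • α t = (2 : ℝ) • α s := by
    have : (2 : ℝ) • α s - αv t (α s) • α t = 0 := by rw [← h2]; module
    exact (sub_eq_zero.1 this).symm
  have hφ : ∀ v, ∃ c : ℝ, ρ g v = v + c • α s := by
    intro v
    refine ⟨-(αv t v * (2 / αv t (α s))) - (αv s v - αv t v * αv s (α t)), ?_⟩
    have hb : α t = (2 / αv t (α s)) • α s := by
      rw [div_eq_inv_mul, mul_smul, ← hprop, smul_smul, inv_mul_cancel₀ hy.ne, one_smul]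
    rw [hg, rho_mul cs α αv hpair ρ hρs]
    nth_rewrite 1 [hb]
    module
  have hfix : ρ g (α s) = α s := by
    rw [hg, rho_mul_self cs α αv hpair ρ hρs, hxy]
    exact sub_eq_zero.1 h2
  have hg1 : g = 1 := by
    apply hρinj
    rw [map_one]
    ext v
    obtain ⟨c, hc⟩ := hφ v
    have hk : ∀ k : ℕ, ρ (g ^ k) v = v + ((k : ℝ) * c) • α s := by
      intro k
      induction k with
      | zero => simp
      | succ k ih =>
        rw [pow_succ', map_mul, LinearEquiv.mul_apply, ih, map_add, map_smul, hfix, hc]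
        push_cast
        module
    have := hk n
    rw [hgn] at this
    have h3 : ((n : ℝ) * c) • α s = 0 := by simpa using this
    have hα : α s ≠ 0 := by
      intro h
      have := hpair s
      rw [h] at this
      simp at this
    have h4 := (smul_eq_zero.1 h3).resolve_right hα
    have h5 := (mul_eq_zero.1 h4).resolve_left hnpos.ne'
    rw [hc, h5]
    simp
  have hseq : cs.simple s = cs.simple t := by
    have := mul_eq_one_iff_eq_inv.1 hg1
    rwa [cs.inv_simple] at this
  have hM2 : ∀ u, u ≠ s → u ≠ t → M s u = 2 := by
    intro u hus hut
    rw [M.symmetric s u]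
    rcases hM u s hus with h | h
    · exact h.1
    · exfalso
      have h6 := congrArg (αv u) hprop
      simp only [map_smul, smul_eq_mul] at h6
      have h7 : αv u (α t) ≤ 0 := by
        rcases hM u t hut with h' | h'
        · exact h'.2.1.le
        · exact h'.1.le
      nlinarith [h.1]
  have hZ : ∀ (z : Multiplicative (ZMod 2)) (k : ℕ), Even k → z ^ k = 1 := by
    intro z k hk
    obtain ⟨r, rfl⟩ := hk
    rw [← two_mul, pow_mul]
    have : ∀ z : Multiplicative (ZMod 2), z ^ 2 = 1 := by decide
    rw [this, one_pow]
  have hlift : M.IsLiftable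
      (fun u => if u = s then Multiplicative.ofAdd (1 : ZMod 2) else 1) := by
    intro i j
    have hev : ∀ u, u ≠ s → Even (M s u) := by
      intro u hu
      by_cases hut : u = t
      · rw [hut, h0]; exact Even.zero
      · rw [hM2 u hu hut]; exact even_two
    by_cases hi : i = s <;> by_cases hj : j = s
    · subst hi; subst hj
      simp only [if_true]
      rw [show Multiplicative.ofAdd (1 : ZMod 2) * Multiplicative.ofAdd (1 : ZMod 2) = 1 from rfl,
        one_pow]
    · subst hi; exact hZ _ _ (hev j hj)
    · subst hj; rw [M.symmetric]; exact hZ _ _ (hev i hi)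
    · simp [hi, hj]
  have e1 := cs.lift_apply_simple hlift s
  have e2 := cs.lift_apply_simple hlift t
  rw [hseq, e2] at e1
  simp only [if_true, if_neg (Ne.symm hst)] at e1
  exact absurd e1 (by decide)

theorem order_eq [Finite W]
    (cs : CoxeterSystem M W) (α : B → V) (αv : B → Module.Dual ℝ V)
    (hpair : ∀ s, αv s (α s) = 2) (ρ : W →* (V ≃ₗ[ℝ] V))
    (hρs : ∀ s v, ρ (cs.simple s) v = v - αv s v • α s)
    (hρinj : Function.Injective ρ)
    (hM : ∀ s s' : B, s ≠ s' →
      (M s s' = 2 ∧ αv s (α s') = 0 ∧ αv s' (α s) = 0) ∨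
      (αv s (α s') < 0 ∧ αv s' (α s) < 0 ∧
        αv s (α s') * αv s' (α s) = 4 * Real.cos (Real.pi / (M s s' : ℝ)) ^ 2))
    (s t : B) (hst : s ≠ t) :
    0 < M s t ∧ orderOf (cs.simple s * cs.simple t) = M s t := by
  have h0 := order_ne_zero cs α αv hpair ρ hρs hρinj hM s t hst
  refine ⟨Nat.pos_of_ne_zero h0, Nat.dvd_antisymm
    (orderOf_dvd_of_pow_eq_one (cs.simple_mul_simple_pow s t)) ?_⟩
  have hxy : αv s (α t) * αv t (α s) = 4 * Real.cos (Real.pi / (M s t : ℝ)) ^ 2 := by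
    rcases hM s t hst with ⟨h1, h2, h3⟩ | h
    · rw [h1, h2]; simp
    · exact h.2.2
  have hc := (rho_cos cs α αv hpair ρ hρs s t _ hxy (orderOf (cs.simple s * cs.simple t))).1
  rw [pow_orderOf_eq_one, map_one] at hc
  simp only [LinearEquiv.coe_one, id_eq, hpair] at hc
  set n := orderOf (cs.simple s * cs.simple t)
  have hc1 : Real.cos (2 * n * (Real.pi / (M s t : ℝ))) = 1 := by linarith
  obtain ⟨k, hk⟩ := (Real.cos_eq_one_iff _).1 hc1
  have hM0 : (M s t : ℝ) ≠ 0 := by exact_mod_cast h0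
  have hpi := Real.pi_pos.ne'
  have : (k : ℝ) * M s t = n := by
    field_simp at hk
    nlinarith [hk]
  have h' : (k : ℤ) * (M s t : ℤ) = (n : ℤ) := by exact_mod_cast this
  exact Int.natCast_dvd_natCast.1 ⟨k, by rw [← h']; ring⟩

end Order

section Words

variable {V : Type*} [NormedAddCommGroup V] [NormedSpace ℝ V] [FiniteDimensional ℝ V]
  {B : Type*}

theorem pitman_congr_Icc (α : V) (αv : Module.Dual ℝ V) {T : ℝ} {π π' : ℝ → V}
    (h : EqOn π π' (Icc 0 T)) : EqOn (pitman α αv π) (pitman α αv π') (Icc 0 T) := by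
  intro t ht
  rw [pitman_eq, pitman_eq, h ht]
  congr 2
  apply runInf_congr_at
  intro s hs
  simp only [h ⟨hs.1, hs.2.trans ht.2⟩]

theorem pitmanWord_cons (α : B → V) (αv : B → Module.Dual ℝ V) (s : B) (l : List B) (π : ℝ → V) :
    pitmanWord α αv (s :: l) π = pitman (α s) (αv s) (pitmanWord α αv l π) := rfl

theorem pitmanWord_nil (α : B → V) (αv : B → Module.Dual ℝ V) (π : ℝ → V) :
    pitmanWord α αv [] π = π := rfl

theorem pitmanWord_append (α : B → V) (αv : B → Module.Dual ℝ V) (l l' : List B) (π : ℝ → V) :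
    pitmanWord α αv (l ++ l') π = pitmanWord α αv l (pitmanWord α αv l' π) := by
  induction l with
  | nil => rfl
  | cons s l ih => rw [List.cons_append, pitmanWord_cons, pitmanWord_cons, ih]

theorem pitmanWord_concat_letter (α : B → V) (αv : B → Module.Dual ℝ V) (l : List B) (s : B)
    (π : ℝ → V) :
    pitmanWord α αv (l.concat s) π = pitmanWord α αv l (pitman (α s) (αv s) π) := by
  rw [List.concat_eq_append, pitmanWord_append]
  rfl

theorem pitmanWord_congr_Icc (α : B → V) (αv : B → Module.Dual ℝ V) (l : List B) {T : ℝ}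
    {π π' : ℝ → V} (h : EqOn π π' (Icc 0 T)) :
    EqOn (pitmanWord α αv l π) (pitmanWord α αv l π') (Icc 0 T) := by
  induction l with
  | nil => exact h
  | cons s l ih => exact pitman_congr_Icc _ _ ih

theorem pitmanWord_congr (α : B → V) (αv : B → Module.Dual ℝ V) (l : List B)
    {π π' : ℝ → V} (h : EqOn π π' (Ici 0)) :
    EqOn (pitmanWord α αv l π) (pitmanWord α αv l π') (Ici 0) := fun t ht =>
  pitmanWord_congr_Icc α αv l (T := t) (h.mono Icc_subset_Ici_self) ⟨ht, le_rfl⟩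

theorem pitmanWord_continuousOn (α : B → V) (αv : B → Module.Dual ℝ V) (l : List B)
    {π : ℝ → V} (h : ContinuousOn π (Ici 0)) : ContinuousOn (pitmanWord α αv l π) (Ici 0) := by
  induction l with
  | nil => exact h
  | cons s l ih => exact pitman_continuousOn _ _ ih

theorem pitmanWord_alternating (α : B → V) (αv : B → Module.Dual ℝ V) (k : ℕ) (s t : B)
    (π : ℝ → V) :
    pitmanWord α αv (CoxeterSystem.alternatingWord s t k) π =
      altComp (pitman (α s) (αv s)) (pitman (α t) (αv t)) k π := by
  induction k generalizing s t π with
  | zero => rfl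
  | succ k ih =>
    rw [CoxeterSystem.alternatingWord_succ, pitmanWord_concat_letter, ih, altComp_succ]

theorem pitman_braid (m : ℕ) (hm : 2 ≤ m) (α β : V) (αv βv : Module.Dual ℝ V)
    (hα : αv α = 2) (hβ : βv β = 2)
    (h : (m = 2 ∧ αv β = 0 ∧ βv α = 0) ∨
      (αv β < 0 ∧ βv α < 0 ∧ αv β * βv α = 4 * Real.cos (Real.pi / (m : ℝ)) ^ 2))
    (π : ℝ → V) (hπ : ContinuousOn π (Ici 0)) (t : ℝ) :
    altComp (pitman α αv) (pitman β βv) m π t = altComp (pitman β βv) (pitman α αv) m π t := by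
  rcases h with ⟨rfl, h1, h2⟩ | ⟨h1, h2, h3⟩
  · exact altComp_braid 2 hm 0 (by simp) α β αv βv hα hβ (by simp [h1]) (by simp [h2]) π hπ t
  · have hm' : (2 : ℝ) ≤ m := by exact_mod_cast hm
    have hc : 0 ≤ Real.cos (Real.pi / m) := by
      apply Real.cos_nonneg_of_mem_Icc
      have := Real.pi_pos
      constructor
      · have : 0 ≤ Real.pi / m := by positivity
        linarith
      · exact div_le_div_of_nonneg_left this.le (by norm_num) hm'
    have hab := mul_pos_of_neg_of_neg h1 h2
    have hc' : 0 < Real.cos (Real.pi / m) := by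
      rcases hc.lt_or_eq with h | h
      · exact h
      · rw [← h] at h3
        norm_num at h3
        rcases h3 with h3 | h3 <;> linarith
    set c := Real.cos (Real.pi / m) with hcdef
    have hκ : 0 < 2 * c / (-αv β) := div_pos (by linarith) (by linarith)
    have hr := pitman_rescale β βv _ hκ
    rw [← hr]
    refine altComp_braid m hm (2 * c) rfl α _ αv _ hα ?_ ?_ ?_ π hπ t
    · simp only [map_smul, LinearMap.smul_apply, smul_eq_mul, hβ]
      have := h1.ne
      field_simp
    · simp only [map_smul, smul_eq_mul]
      have := h1.ne
      field_simp
    · simp only [LinearMap.smul_apply, smul_eq_mul]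
      have := h1.ne
      field_simp
      linarith

end Words

section Step

variable {V : Type*} [NormedAddCommGroup V] [NormedSpace ℝ V] [FiniteDimensional ℝ V]

theorem runInf_shift {u q : ℝ → ℝ} (hu : ContinuousOn u (Ici 0)) (h0 : u 0 = 0) {x : ℝ}
    (hx : 0 ≤ x) (hq : ∀ t, q t = min 0 (x + runInf u t)) {t : ℝ} (ht : 0 ≤ t) :
    q t + runInf (fun s => u s - 2 * q s) t = runInf u t := by
  have hqc : ContinuousOn q (Ici 0) := by
    have : q = fun t => min 0 (x + runInf u t) := funext hq
    rw [this]
    exact continuousOn_const.inf (continuousOn_const.add (runInf_continuousOn hu))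
  have hvc : ContinuousOn (fun s => u s - 2 * q s) (Ici 0) :=
    hu.sub (continuousOn_const.mul hqc)
  by_cases hc : -x ≤ runInf u t
  · have hz : ∀ s, 0 ≤ s → s ≤ t → q s = 0 := by
      intro s hs hst
      rw [hq, min_eq_left]
      have := runInf_anti hu hs hst
      linarith
    rw [hz t ht le_rfl, zero_add]
    apply runInf_congr_at
    intro s hs
    simp [hz s hs.1 hs.2]
  · push Not at hc
    have hqt : q t = x + runInf u t := by rw [hq, min_eq_right]; linarith
    rw [hqt]
    have : runInf (fun s => u s - 2 * q s) t = -x := by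
      apply le_antisymm
      · have h00 : runInf u 0 = 0 := by
          rw [runInf]; simp [h0]
        obtain ⟨s, hs, hst, hus, hrs⟩ := exists_level hu le_rfl ht hc (by rw [h00]; linarith)
        have := runInf_le hvc hs hst
        have hqs : q s = 0 := by rw [hq, hrs]; simp
        simpa only [hus, hqs, mul_zero, sub_zero] using this
      · apply le_runInf ht
        intro s hs hst
        have h1 := runInf_le hu hs le_rfl
        rw [hq]
        rcases le_total 0 (x + runInf u s) with h | h
        · rw [min_eq_left h]; linarith
        · rw [min_eq_right h]; linarith
    rw [this]; ring

theorem pitman_concat_step (α : V) (αv : Module.Dual ℝ V) (hα : αv α = 2) {T : ℝ} (hT : 0 < T)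
    {π η : ℝ → V} (hπ : ContinuousOn π (Ici 0)) (hη : ContinuousOn η (Ici 0)) (hη0 : η 0 = 0) :
    ∃ η' : ℝ → V, ContinuousOn η' (Ici 0) ∧ η' 0 = 0 ∧
      EqOn (pitman α αv (concatPath T π η)) (concatPath T (pitman α αv π) η') (Icc 0 T) ∧
      EqOn (pitman α αv η') (pitman α αv η) (Ici 0) := by
  set p : ℝ → ℝ := fun s => αv (π s) with hp
  set u : ℝ → ℝ := fun s => αv (η s) with hu
  have hpc : ContinuousOn p (Ici 0) := dual_continuousOn αv hπ
  have huc : ContinuousOn u (Ici 0) := dual_continuousOn αv hη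
  have hu0 : u 0 = 0 := by simp [hu, hη0]
  set x : ℝ := p T - runInf p T with hx
  have hx0 : 0 ≤ x := sub_nonneg.2 (runInf_le hpc hT.le le_rfl)
  set q : ℝ → ℝ := fun t => min 0 (x + runInf u t) with hq
  have hqc : ContinuousOn q (Ici 0) :=
    continuousOn_const.inf (continuousOn_const.add (runInf_continuousOn huc))
  have hr0 : runInf u 0 = 0 := by rw [runInf]; simp [hu0]
  refine ⟨fun t => η t - q t • α, hη.sub (hqc.smul continuousOn_const), ?_, ?_, ?_⟩
  · simp [hη0, hq, hr0, hx0]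
  · intro t ht
    rw [pitman_eq]
    by_cases h : t ≤ T / 2
    · simp only [concatPath, if_pos h, pitman_eq]
      congr 2
      unfold runInf
      congr 1
      ext y
      constructor
      · rintro ⟨s, hs, rfl⟩
        refine ⟨2 * s, ⟨by linarith [hs.1], by linarith [hs.2]⟩, ?_⟩
        simp only [if_pos (hs.2.trans h)]
      · rintro ⟨s, hs, rfl⟩
        refine ⟨s / 2, ⟨by linarith [hs.1], by linarith [hs.2]⟩, ?_⟩
        simp only [if_pos (show s / 2 ≤ T / 2 by linarith [hs.2])]
        rw [mul_div_cancel₀ s two_ne_zero]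
    · have key : runInf (fun s => αv (concatPath T π η s)) t =
          runInf p T + q (2 * t - T) := by
        push Not at h
        have h2 : 0 ≤ 2 * t - T := by linarith
        have e : runInf p T + q (2 * t - T) = min (runInf p T) (p T + runInf u (2 * t - T)) := by
          simp only [hq, hx]
          rw [← min_add_add_left]
          congr 1 <;> ring
        rw [e]
        have hval1 : ∀ s, s ≤ T / 2 → αv (concatPath T π η s) = p (2 * s) := by
          intro s hs
          simp only [concatPath, if_pos hs, hp]
        have hval2 : ∀ s, T / 2 ≤ s → αv (concatPath T π η s) = p T + u (2 * s - T) := by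
          intro s hs
          rcases hs.eq_or_lt with rfl | hs
          · rw [hval1 _ le_rfl, mul_div_cancel₀ T two_ne_zero]
            simp [hu0]
          · simp only [concatPath, if_neg (not_le.2 hs), map_add, hp, hu]
        have hbd : ∀ s, 0 ≤ s → s ≤ t → min (runInf p T) (p T + runInf u (2 * t - T)) ≤
            αv (concatPath T π η s) := by
          intro s hs hst
          rcases le_total s (T / 2) with h' | h'
          · rw [hval1 s h']
            exact (min_le_left _ _).trans (runInf_le hpc (by linarith) (by linarith))
          · rw [hval2 s h']
            refine (min_le_right _ _).trans ?_
            have := runInf_le huc (s := 2 * s - T) (t := 2 * t - T) (by linarith) (by linarith)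
            linarith
        have hbdd : BddBelow ((fun s => αv (concatPath T π η s)) '' Icc 0 t) := by
          refine ⟨min (runInf p T) (p T + runInf u (2 * t - T)), ?_⟩
          rintro _ ⟨s, hs, rfl⟩
          exact hbd s hs.1 hs.2
        apply le_antisymm
        · apply le_min
          · obtain ⟨s, hs, hsT, hse⟩ := runInf_attained hpc hT.le
            rw [hse]
            refine csInf_le hbdd ⟨s / 2, ⟨by linarith, by linarith⟩, ?_⟩
            simp only
            rw [hval1 _ (by linarith), mul_div_cancel₀ s two_ne_zero]
          · obtain ⟨s, hs, hsT, hse⟩ := runInf_attained huc h2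
            rw [hse]
            refine csInf_le hbdd ⟨(s + T) / 2, ⟨by linarith, by linarith⟩, ?_⟩
            simp only
            rw [hval2 _ (by linarith)]
            congr 2
            ring
        · exact le_runInf ht.1 hbd
      rw [key]
      simp only [concatPath, if_neg h, pitman_eq]
      module
  · intro t ht
    have := runInf_shift huc hu0 hx0 (q := q) (fun _ => rfl) ht
    rw [pitman_eq, pitman_eq]
    have e : (fun s => αv (η s - q s • α)) = fun s => u s - 2 * q s := by
      funext s
      simp only [map_sub, map_smul, smul_eq_mul, hα, hu]
      ring
    rw [e, ← hu, ← this]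
    module

end Step

section Main

variable {V : Type*} [NormedAddCommGroup V] [NormedSpace ℝ V] [FiniteDimensional ℝ V]
    {B : Type*} {W : Type*} [Group W] [Finite W] {M : CoxeterMatrix B}

theorem pitmanWord_indep (cs : CoxeterSystem M W)
    (α : B → V) (αv : B → Module.Dual ℝ V)
    (hpair : ∀ s, αv s (α s) = 2)
    (ρ : W →* (V ≃ₗ[ℝ] V)) (hρinj : Function.Injective ρ)
    (hρs : ∀ s v, ρ (cs.simple s) v = v - αv s v • α s)
    (hM : ∀ s s' : B, s ≠ s' →
      (M s s' = 2 ∧ αv s (α s') = 0 ∧ αv s' (α s) = 0) ∨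
      (αv s (α s') < 0 ∧ αv s' (α s) < 0 ∧
        αv s (α s') * αv s' (α s) = 4 * Real.cos (Real.pi / (M s s' : ℝ)) ^ 2))
    (l l' : List B) (hl : cs.IsReduced l) (hl' : cs.IsReduced l')
    (he : cs.wordProd l = cs.wordProd l') (π : ℝ → V) (hπ : ContinuousOn π (Ici 0)) :
    EqOn (pitmanWord α αv l π) (pitmanWord α αv l' π) (Ici 0) := by
  have hord := order_eq cs α αv hpair ρ hρs hρinj hM
  refine matsumoto cs hord (fun l l' => ∀ π : ℝ → V, ContinuousOn π (Ici 0) →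
    EqOn (pitmanWord α αv l π) (pitmanWord α αv l' π) (Ici 0)) ?_ ?_ ?_ ?_ l.length l l' rfl
    hl hl' he π hπ
  · intro l π _ t _
    rfl
  · intro l₁ l₂ l₃ h1 h2 π hπ
    exact (h1 π hπ).trans (h2 π hπ)
  · intro l₁ l₂ s h π hπ
    rw [pitmanWord_concat_letter, pitmanWord_concat_letter]
    exact h _ (pitman_continuousOn _ _ hπ)
  · intro s t hst l π hπ
    rw [pitmanWord_append, pitmanWord_append]
    apply pitmanWord_congr
    intro r _
    rw [pitmanWord_alternating, pitmanWord_alternating]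
    have h0 := (hord s t hst).1
    have h1 := M.off_diagonal s t hst
    exact pitman_braid (M s t) (by change M s t ≠ 1 at h1; omega) _ _ _ _ (hpair s) (hpair t)
      (hM s t hst) π hπ r

theorem pitmanWord_concat_aux (cs : CoxeterSystem M W)
    (α : B → V) (αv : B → Module.Dual ℝ V)
    (hpair : ∀ s, αv s (α s) = 2)
    (ρ : W →* (V ≃ₗ[ℝ] V)) (hρinj : Function.Injective ρ)
    (hρs : ∀ s v, ρ (cs.simple s) v = v - αv s v • α s)
    (hM : ∀ s s' : B, s ≠ s' →
      (M s s' = 2 ∧ αv s (α s') = 0 ∧ αv s' (α s) = 0) ∨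
      (αv s (α s') < 0 ∧ αv s' (α s) < 0 ∧
        αv s (α s') * αv s' (α s) = 4 * Real.cos (Real.pi / (M s s' : ℝ)) ^ 2))
    (w₀ : W) (hw₀ : ∀ w : W, cs.length w ≤ cs.length w₀) {T : ℝ} (hT : 0 < T)
    (π η : ℝ → V) (hπ : ContinuousOn π (Ici 0)) (hη : ContinuousOn η (Ici 0)) (hη0 : η 0 = 0)
    (l : List B) :
    ∃ η' : ℝ → V, ContinuousOn η' (Ici 0) ∧ η' 0 = 0 ∧
      EqOn (pitmanWord α αv l (concatPath T π η)) (concatPath T (pitmanWord α αv l π) η')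
        (Icc 0 T) ∧
      (∀ l₀ : List B, cs.wordProd l₀ = w₀ → cs.IsReduced l₀ →
        EqOn (pitmanWord α αv l₀ η') (pitmanWord α αv l₀ η) (Ici 0)) := by
  induction l with
  | nil => exact ⟨η, hη, hη0, fun _ _ => rfl, fun _ _ _ _ _ => rfl⟩
  | cons s l ih =>
    obtain ⟨η₁, h1c, h10, h1e, h1w⟩ := ih
    obtain ⟨η₂, h2c, h20, h2e, h2p⟩ := pitman_concat_step (α s) (αv s) (hpair s) hT
      (pitmanWord_continuousOn α αv l hπ) h1c h10
    refine ⟨η₂, h2c, h20, ?_, ?_⟩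
    · rw [pitmanWord_cons, pitmanWord_cons]
      exact (pitman_congr_Icc _ _ h1e).trans h2e
    · intro l₀ hl₀ hr₀
      obtain ⟨l₁, hl₁, hw₁⟩ := cs.exists_isReduced (w₀ * cs.simple s)
      have hlen : cs.length (w₀ * cs.simple s) + 1 = cs.length w₀ := by
        rcases cs.length_mul_simple w₀ s with h | h
        · have := hw₀ (w₀ * cs.simple s)
          omega
        · exact h
      have hprod : cs.wordProd (l₁.concat s) = w₀ := by
        rw [cs.wordProd_concat, ← hw₁, mul_assoc, cs.simple_mul_simple_self, mul_one]
      have hred : cs.IsReduced (l₁.concat s) := by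
        rw [CoxeterSystem.IsReduced, hprod, List.length_concat, ← hlen, hw₁, hl₁.eq]
      have hind := pitmanWord_indep cs α αv hpair ρ hρinj hρs hM l₀ (l₁.concat s) hr₀ hred
        (hl₀.trans hprod.symm)
      refine (hind η₂ h2c).trans (EqOn.trans ?_ ((hind η₁ h1c).symm.trans (h1w l₀ hl₀ hr₀)))
      rw [pitmanWord_concat_letter, pitmanWord_concat_letter]
      exact pitmanWord_congr α αv l₁ h2p

theorem clamp_spec {T : ℝ} (hT : 0 < T) {π : ℝ → V} (hπ : ContinuousOn π (Icc 0 T)) :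
    ∃ π' : ℝ → V, ContinuousOn π' (Ici 0) ∧ EqOn π' π (Icc 0 T) := by
  refine ⟨fun t => π (min t T), ?_, ?_⟩
  · refine hπ.comp (by fun_prop) ?_
    intro t ht
    exact ⟨le_min ht hT.le, min_le_right _ _⟩
  · intro t ht
    simp only [min_eq_left ht.2]

theorem concatPath_congr {T : ℝ} (hT : 0 < T) {π π' η η' : ℝ → V} (h1 : EqOn π π' (Icc 0 T))
    (h2 : EqOn η η' (Icc 0 T)) : EqOn (concatPath T π η) (concatPath T π' η') (Icc 0 T) := by
  intro t ht
  obtain ⟨ha, hb⟩ := ht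
  by_cases h : t ≤ T / 2
  · simp only [concatPath, if_pos h]
    exact h1 ⟨by linarith, by linarith⟩
  · simp only [concatPath, if_neg h]
    push Not at h
    rw [h1 ⟨hT.le, le_rfl⟩, h2 ⟨by linarith, by linarith⟩]

end Main

end PitmanAux

/-- Lemma 4.7 of Biane–Bougerol–O'Connell (concatenation lemma): for every `w ∈ W`
(with reduced word `l`) there is a path `η'` with
`P_w (π ⋆ η) = (P_w π) ⋆ η'` and `P_{w₀} η' = P_{w₀} η`, where `w₀` is the longest
element of the finite Coxeter group `W` and `P_{w₀}` is computed along any reduced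
word `l₀` for `w₀`. -/
theorem pitmanWord_concat
    {V : Type*} [NormedAddCommGroup V] [NormedSpace ℝ V] [FiniteDimensional ℝ V]
    (T : ℝ) (hT : 0 < T)
    {B : Type*} [Fintype B] {W : Type*} [Group W] [Finite W]
    (M : CoxeterMatrix B) (cs : CoxeterSystem M W)
    (α : B → V) (αv : B → Module.Dual ℝ V)
    (hpair : ∀ s, αv s (α s) = 2)
    (ρ : W →* (V ≃ₗ[ℝ] V)) (hρinj : Function.Injective ρ)
    (hρs : ∀ s v, ρ (cs.simple s) v = v - αv s v • α s)
    (hM : ∀ s s' : B, s ≠ s' →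
      (M s s' = 2 ∧ αv s (α s') = 0 ∧ αv s' (α s) = 0) ∨
      (αv s (α s') < 0 ∧ αv s' (α s) < 0 ∧
        αv s (α s') * αv s' (α s) = 4 * Real.cos (Real.pi / (M s s' : ℝ)) ^ 2))
    (w₀ : W) (hw₀ : ∀ w : W, cs.length w ≤ cs.length w₀)
    (π η : ℝ → V) (hπcont : ContinuousOn π (Set.Icc 0 T)) (hπ0 : π 0 = 0)
    (hηcont : ContinuousOn η (Set.Icc 0 T)) (hη0 : η 0 = 0)
    (w : W) (l : List B) (hl : cs.wordProd l = w) (hlred : cs.IsReduced l) :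
    ∃ η' : ℝ → V, ContinuousOn η' (Set.Icc 0 T) ∧ η' 0 = 0 ∧
      (∀ t ∈ Set.Icc 0 T,
        pitmanWord α αv l (concatPath T π η) t
          = concatPath T (pitmanWord α αv l π) η' t) ∧
      (∀ l₀ : List B, cs.wordProd l₀ = w₀ → cs.IsReduced l₀ →
        ∀ t ∈ Set.Icc 0 T,
          pitmanWord α αv l₀ η' t = pitmanWord α αv l₀ η t) := by
  obtain ⟨π₁, hπ₁, eπ⟩ := clamp_spec hT hπcont
  obtain ⟨η₁, hη₁, eη⟩ := clamp_spec hT hηcont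
  have h00 : (0 : ℝ) ∈ Set.Icc 0 T := ⟨le_rfl, hT.le⟩
  obtain ⟨η', hc, h0, h1, h2⟩ := pitmanWord_concat_aux cs α αv hpair ρ hρinj hρs hM w₀ hw₀ hT
    π₁ η₁ hπ₁ hη₁ ((eη h00).trans hη0) l
  refine ⟨η', hc.mono Set.Icc_subset_Ici_self, h0, ?_, ?_⟩
  · intro t ht
    rw [← pitmanWord_congr_Icc α αv l (concatPath_congr hT eπ eη) ht, h1 ht]
    exact concatPath_congr hT (pitmanWord_congr_Icc α αv l eπ) (fun _ _ => rfl) ht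
  · intro l₀ hl₀ hr₀ t ht
    rw [h2 l₀ hl₀ hr₀ ht.1]
    exact pitmanWord_congr_Icc α αv l₀ eη ht
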